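/- A symmetric P₀-tensor with all entries nonnegative is doubly nonnegative, and an even-order doubly nonnegative tensor is a P₀-tensor. That is: (i) if A is a symmetric m-th order n-dimensional real P₀-tensor all of whose entries are nonnegative, then every H-eigenvalue of A is nonnegative (so A is doubly nonnegative); (ii) if m is even and A is a symmetric m-th order n-dimensional tensor with all entries nonnegative and all H-eigenvalues nonnegative, then A is a P₀-tensor. -/

import Mathlib

open Finset

/-- `tvec A x i` is the `i`-th component of `A x^{m-1}` for an `m = k+1`-th order tensor `A`
with index set `ι`. -/
def tvec {ι : Type*} [Fintype ι] {k : ℕ} (A : (Fin (k + 1) → ι) → ℝ)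
    (x : ι → ℝ) (i : ι) : ℝ :=
  ∑ g : Fin k → ι, A (Fin.cons i g) * ∏ j, x (g j)

/-- `A x^m`, the homogeneous form associated with `A`. -/
def tform {ι : Type*} [Fintype ι] {k : ℕ} (A : (Fin (k + 1) → ι) → ℝ)
    (x : ι → ℝ) : ℝ :=
  ∑ i, x i * tvec A x i

/-- `A` is a P-tensor. -/
def IsPTensor {ι : Type*} [Fintype ι] {k : ℕ} (A : (Fin (k + 1) → ι) → ℝ) : Prop :=
  ∀ x : ι → ℝ, x ≠ 0 → ∃ i, 0 < x i ^ k * tvec A x i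

/-- `A` is a P₀-tensor. -/
def IsP0Tensor {ι : Type*} [Fintype ι] {k : ℕ} (A : (Fin (k + 1) → ι) → ℝ) : Prop :=
  ∀ x : ι → ℝ, x ≠ 0 → ∃ i, x i ≠ 0 ∧ 0 ≤ x i ^ k * tvec A x i

/-- `A` is a symmetric tensor. -/
def IsSymmTensor {ι : Type*} {k : ℕ} (A : (Fin (k + 1) → ι) → ℝ) : Prop :=
  ∀ (σ : Equiv.Perm (Fin (k + 1))) (f : Fin (k + 1) → ι), A (f ∘ σ) = A f

/-- `A` is a completely positive tensor: a sum of `m`-th outer powers of nonnegative vectors. -/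
def IsCPTensor {n k : ℕ} (A : (Fin (k + 1) → Fin n) → ℝ) : Prop :=
  ∃ (r : ℕ) (u : Fin r → Fin n → ℝ), (∀ l i, 0 ≤ u l i) ∧
    ∀ f : Fin (k + 1) → Fin n, A f = ∑ l, ∏ t, u l (f t)

/-- `A` is a strongly completely positive tensor: a sum of `m`-th outer powers of nonnegative
vectors which span the whole space. -/
def IsSCPTensor {n k : ℕ} (A : (Fin (k + 1) → Fin n) → ℝ) : Prop :=
  ∃ (r : ℕ) (u : Fin r → Fin n → ℝ), (∀ l i, 0 ≤ u l i) ∧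
    (∀ f : Fin (k + 1) → Fin n, A f = ∑ l, ∏ t, u l (f t)) ∧
    Submodule.span ℝ (Set.range u) = ⊤

section TensorForm

variable {ι : Type*} [Fintype ι] {k : ℕ}

theorem tform_eq_sum_prod (A : (Fin (k + 1) → ι) → ℝ) (x : ι → ℝ) :
    tform A x = ∑ f, A f * ∏ j, x (f j) := by
  rw [← (Fin.consEquiv fun _ : Fin (k + 1) => ι).sum_comp, Fintype.sum_prod_type]
  simp only [tform, tvec, Fin.consEquiv, Equiv.coe_fn_mk, Fin.prod_univ_succ, Fin.cons_zero, Fin.cons_succ,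
    Finset.mul_sum]
  exact Finset.sum_congr rfl fun _ _ => Finset.sum_congr rfl fun _ _ => by ring

theorem tform_smul (A : (Fin (k + 1) → ι) → ℝ) (c : ℝ) (x : ι → ℝ) :
    tform A (c • x) = c ^ (k + 1) * tform A x := by
  simp only [tform_eq_sum_prod, Pi.smul_apply, smul_eq_mul, Finset.prod_mul_distrib,
    Finset.prod_const, Finset.card_univ, Fintype.card_fin, Finset.mul_sum]
  exact Finset.sum_congr rfl fun _ _ => by ring

theorem continuous_tform (A : (Fin (k + 1) → ι) → ℝ) : Continuous (tform A) := by
  unfold tform tvec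
  fun_prop

/-- For a symmetric tensor, every slot contributes equally to the derivative of the form. -/
theorem IsSymmTensor.sum_mul_prod_erase {A : (Fin (k + 1) → ι) → ℝ} (hA : IsSymmTensor A)
    (x v : ι → ℝ) (l : Fin (k + 1)) :
    ∑ f, A f * ((∏ j ∈ univ.erase l, x (f j)) * v (f l)) = ∑ i, v i * tvec A x i := by
  have hswap : ∀ f : Fin (k + 1) → ι,
      ∏ j ∈ univ.erase l, x (f (Equiv.swap 0 l j)) = ∏ j : Fin k, x (f j.succ) := by
    intro f
    rw [← Finset.prod_image (s := univ) (g := fun j : Fin k => j.succ)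
      (f := fun j => x (f j)) (fun a _ b _ h => Fin.succ_injective _ h)]
    refine Finset.prod_nbij (Equiv.swap 0 l) ?_ (Equiv.injective _).injOn ?_ fun _ _ => rfl
    · intro j hj
      have hne : Equiv.swap 0 l j ≠ 0 := fun h =>
        (Finset.mem_erase.1 hj).1 (by simpa [Equiv.swap_apply_eq_iff] using h)
      obtain ⟨i, hi⟩ := Fin.exists_succ_eq.2 hne
      exact Finset.mem_image.2 ⟨i, Finset.mem_univ _, hi⟩
    · intro j hj
      obtain ⟨i, -, rfl⟩ := Finset.mem_image.1 (Finset.mem_coe.1 hj)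
      refine ⟨Equiv.swap 0 l i.succ, ?_, by simp⟩
      simp [Equiv.swap_apply_eq_iff]
  rw [← ((Equiv.swap 0 l).arrowCongr (Equiv.refl ι)).sum_comp,
    ← (Fin.consEquiv fun _ : Fin (k + 1) => ι).sum_comp, Fintype.sum_prod_type]
  refine Finset.sum_congr rfl fun i _ => ?_
  rw [tvec, Finset.mul_sum]
  refine Finset.sum_congr rfl fun g _ => ?_
  have h1 : (Equiv.swap 0 l).arrowCongr (Equiv.refl ι) (Fin.cons i g : Fin (k + 1) → ι) =
      (Fin.cons i g : Fin (k + 1) → ι) ∘ Equiv.swap 0 l := by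
    ext j
    simp [Equiv.arrowCongr]
  change A ((Equiv.swap 0 l).arrowCongr (Equiv.refl ι) (Fin.cons i g : Fin (k + 1) → ι)) *
    ((∏ j ∈ univ.erase l, x ((Equiv.swap 0 l).arrowCongr (Equiv.refl ι)
      (Fin.cons i g : Fin (k + 1) → ι) j)) * v ((Equiv.swap 0 l).arrowCongr (Equiv.refl ι)
      (Fin.cons i g : Fin (k + 1) → ι) l)) = _
  rw [h1, hA]
  simp only [Function.comp_apply]
  rw [hswap]
  simp only [Fin.cons_succ, Equiv.swap_apply_right, Fin.cons_zero]
  ring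

theorem IsSymmTensor.hasDerivAt_tform {A : (Fin (k + 1) → ι) → ℝ} (hA : IsSymmTensor A)
    (x v : ι → ℝ) :
    HasDerivAt (fun t : ℝ => tform A (x + t • v)) ((k + 1) * ∑ i, v i * tvec A x i) 0 := by
  have hline : ∀ i, HasDerivAt (fun t : ℝ => x i + t * v i) (v i) 0 := fun i => by
    simpa using ((hasDerivAt_id (0 : ℝ)).mul_const (v i)).const_add (x i)
  have h := HasDerivAt.fun_sum (u := univ) fun (f : Fin (k + 1) → ι) _ =>
    (HasDerivAt.fun_finsetProd (u := univ) fun j _ => hline (f j)).const_mul (A f)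
  simp only [tform_eq_sum_prod, Pi.add_apply, Pi.smul_apply, smul_eq_mul]
  refine h.congr_deriv ?_
  simp only [zero_mul, add_zero, smul_eq_mul, Finset.mul_sum]
  rw [Finset.sum_comm]
  simp only [← Finset.mul_sum, hA.sum_mul_prod_erase]
  simp

theorem sum_pow_pos_of_even {m : ℕ} (hm : Even m) {x : ι → ℝ} (hx : x ≠ 0) :
    0 < ∑ i, x i ^ m := by
  obtain ⟨i, hi⟩ := Function.ne_iff.1 hx
  exact Finset.sum_pos' (fun j _ => hm.pow_nonneg _) ⟨i, Finset.mem_univ _, hm.pow_pos hi⟩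

/-- The minimum of the Rayleigh quotient `A x^m / ∑ i, x i ^ m` of an even-order tensor. -/
theorem exists_tform_eq_and_le (hk : Even (k + 1)) (A : (Fin (k + 1) → ι) → ℝ)
    [Nonempty ι] :
    ∃ (lam : ℝ) (x : ι → ℝ), x ≠ 0 ∧ tform A x = lam * ∑ i, x i ^ (k + 1) ∧
      ∀ y, lam * ∑ i, y i ^ (k + 1) ≤ tform A y := by
  have hne : ∀ x ∈ Metric.sphere (0 : ι → ℝ) 1, x ≠ 0 := fun x hx =>
    ne_zero_of_mem_unit_sphere (⟨x, hx⟩ : Metric.sphere (0 : ι → ℝ) 1)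
  obtain ⟨x, hx, hmin⟩ := (isCompact_sphere (0 : ι → ℝ) 1).exists_isMinOn
    (NormedSpace.sphere_nonempty.2 zero_le_one)
    (f := fun x => tform A x / ∑ i, x i ^ (k + 1))
    ((continuous_tform A).continuousOn.div (by fun_prop) fun x hx =>
      (sum_pow_pos_of_even hk (hne x hx)).ne')
  refine ⟨tform A x / ∑ i, x i ^ (k + 1), x, hne x hx,
    (div_mul_cancel₀ _ (sum_pow_pos_of_even hk (hne x hx)).ne').symm, fun y => ?_⟩
  rcases eq_or_ne y 0 with rfl | hy
  · simp [tform]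
  have hy' : 0 < ‖y‖ := norm_pos_iff.2 hy
  have hmem : ‖y‖⁻¹ • y ∈ Metric.sphere (0 : ι → ℝ) 1 := by
    simp [norm_smul, hy'.ne']
  rw [← le_div_iff₀ (sum_pow_pos_of_even hk hy)]
  refine (hmin hmem).trans_eq ?_
  simp only [tform_smul, Pi.smul_apply, smul_eq_mul, mul_pow, ← Finset.mul_sum]
  exact mul_div_mul_left _ _ (by positivity)

/-- The form of an even-order symmetric tensor without negative H-eigenvalues is nonnegative. -/
theorem IsSymmTensor.tform_nonneg (hk : Even (k + 1)) {A : (Fin (k + 1) → ι) → ℝ}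
    (hA : IsSymmTensor A)
    (hev : ∀ (lam : ℝ) (x : ι → ℝ), x ≠ 0 → (∀ i, tvec A x i = lam * x i ^ k) → 0 ≤ lam)
    (y : ι → ℝ) : 0 ≤ tform A y := by
  classical
  rcases isEmpty_or_nonempty ι with hι | hι
  · simp [tform]
  obtain ⟨lam, x, hx, heq, hle⟩ := exists_tform_eq_and_le hk A
  refine le_trans (mul_nonneg (hev lam x hx fun i => ?_)
    (Finset.sum_nonneg fun i _ => hk.pow_nonneg (y i))) (hle y)
  have hpow : HasDerivAt (fun t : ℝ => ∑ j, (x + t • (Pi.single i (1 : ℝ) : ι → ℝ)) j ^ (k + 1))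
      ((k + 1) * x i ^ k) 0 := by
    have h := HasDerivAt.fun_sum (u := univ) fun (j : ι) _ =>
      (((hasDerivAt_id (0 : ℝ)).mul_const ((Pi.single i (1 : ℝ) : ι → ℝ) j)).const_add
        (x j)).fun_pow (k + 1)
    refine h.congr_deriv ?_
    simp [Pi.single_apply]
  have hderiv := (hA.hasDerivAt_tform x (Pi.single i 1)).sub (hpow.const_mul lam)
  have hloc : IsLocalMin ((fun t : ℝ => tform A (x + t • (Pi.single i (1 : ℝ) : ι → ℝ))) -
      fun t : ℝ => lam * ∑ j, (x + t • (Pi.single i (1 : ℝ) : ι → ℝ)) j ^ (k + 1)) 0 :=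
    Filter.Eventually.of_forall fun t => by
      have := hle (x + t • Pi.single i (1 : ℝ))
      simp only [Pi.sub_apply, zero_smul, add_zero, heq, sub_self]
      linarith
  have hzero := hloc.hasDerivAt_eq_zero hderiv
  simp only [Pi.single_apply, ite_mul, one_mul, zero_mul, Finset.sum_ite_eq', Finset.mem_univ,
    if_true] at hzero
  have hk1 : (k + 1 : ℝ) ≠ 0 := by positivity
  refine mul_left_cancel₀ hk1 ?_
  linarith

theorem isP0Tensor_of_tform_nonneg (hk : Even (k + 1)) {A : (Fin (k + 1) → ι) → ℝ}
    (h : ∀ x, 0 ≤ tform A x) : IsP0Tensor A := by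
  intro x hx
  by_contra! hneg
  obtain ⟨i, hi⟩ := Function.ne_iff.1 hx
  have hlt : ∀ j, x j ≠ 0 → x j * tvec A x j < 0 := by
    intro j hj
    have h1 : x j ^ (k + 1) * (x j * tvec A x j) = x j ^ 2 * (x j ^ k * tvec A x j) := by ring
    have h2 := mul_neg_of_pos_of_neg (by positivity : 0 < x j ^ 2) (hneg j hj)
    exact (pos_iff_neg_of_mul_neg (h1 ▸ h2)).1 (hk.pow_pos hj)
  refine (h x).not_gt (Finset.sum_neg' (fun j _ => ?_) ⟨i, Finset.mem_univ _, hlt i hi⟩)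
  rcases eq_or_ne (x j) 0 with hj | hj
  · simp [hj]
  · exact (hlt j hj).le

theorem IsP0Tensor.eigenvalue_nonneg {A : (Fin (k + 1) → ι) → ℝ} (hA : IsP0Tensor A)
    {lam : ℝ} {x : ι → ℝ} (hx : x ≠ 0) (h : ∀ i, tvec A x i = lam * x i ^ k) : 0 ≤ lam := by
  obtain ⟨i, hi, hnn⟩ := hA x hx
  rw [h i, mul_left_comm] at hnn
  exact nonneg_of_mul_nonneg_left hnn (mul_self_pos.2 (pow_ne_zero k hi))

end TensorForm

/-- A symmetric nonnegative P₀-tensor is doubly nonnegative, and an even-order doubly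
nonnegative tensor is a P₀-tensor. -/
theorem p0_dnn_relation {n k : ℕ} :
    (∀ A : (Fin (k + 1) → Fin n) → ℝ, IsSymmTensor A → (∀ f, 0 ≤ A f) → IsP0Tensor A →
      ∀ (lam : ℝ) (x : Fin n → ℝ), x ≠ 0 → (∀ i, tvec A x i = lam * x i ^ k) → 0 ≤ lam) ∧
    (Even (k + 1) → ∀ A : (Fin (k + 1) → Fin n) → ℝ, IsSymmTensor A → (∀ f, 0 ≤ A f) →
      (∀ (lam : ℝ) (x : Fin n → ℝ), x ≠ 0 → (∀ i, tvec A x i = lam * x i ^ k) → 0 ≤ lam) →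
      IsP0Tensor A) := by
  exact ⟨fun _ _ _ hP0 _ _ hx h => hP0.eigenvalue_nonneg hx h,
    fun hk _ hA _ hev => isP0Tensor_of_tform_nonneg hk (hA.tform_nonneg hk hev)⟩
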